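/- Let d ≥ 2 be an integer and p a real number with p ∈ (1,2) ∪ (2, 2d/(d−2)) if d ≥ 3, and p ∈ (1,2) ∪ (2,5) ∪ (5,∞) if d = 2. Set θ = (d−1)²(p−1)/(d(d+2)+p−1) and let λ be a real number with 0 < λ < (1−θ)·4π². If v : ℝ^d → ℝ is a twice continuously differentiable, ℤ^d-periodic function with v(x) > 0 for all x, satisfying −Δv(x) + (λ/(p−2))·(v(x) − v(x)^{p−1}) = 0 for all x ∈ ℝ^d, then v is identically equal to 1. -/

import Mathlib

open Real

/-- The i-th partial derivative of f : ℝ^d → ℝ. -/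
noncomputable def pd {d : ℕ} (i : Fin d) (f : (Fin d → ℝ) → ℝ) (x : Fin d → ℝ) : ℝ :=
  fderiv ℝ f x (Pi.single i 1)

/-- The Laplacian of f : ℝ^d → ℝ. -/
noncomputable def lap {d : ℕ} (f : (Fin d → ℝ) → ℝ) (x : Fin d → ℝ) : ℝ :=
  ∑ i, pd i (pd i f) x

open MeasureTheory Set

/-- `ℤ^d`-periodicity of a function on `ℝ^d`. -/
def IsPeriodic {d : ℕ} {E : Type*} (f : (Fin d → ℝ) → E) : Prop :=
  ∀ (x : Fin d → ℝ) (k : Fin d → ℤ), f (x + fun i => (k i : ℝ)) = f x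

theorem IsPeriodic.fderiv_apply {d : ℕ} {E : Type*} [NormedAddCommGroup E] [NormedSpace ℝ E]
    {f : (Fin d → ℝ) → E} (hf : IsPeriodic f) (w : Fin d → ℝ) :
    IsPeriodic fun x => fderiv ℝ f x w := by
  intro x k
  have h : (fun y => f (y + fun i => (k i : ℝ))) = f := funext fun y => hf y k
  have h' := fderiv_comp_add_right (𝕜 := ℝ) (f := f) (x := x) (fun i => (k i : ℝ))
  rw [h] at h'
  simp only [h']

theorem isPeriodic_pd {d : ℕ} {f : (Fin d → ℝ) → ℝ} (hf : IsPeriodic f) (i : Fin d) :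
    IsPeriodic (pd i f) :=
  hf.fderiv_apply _

theorem continuous_pd {d : ℕ} {f : (Fin d → ℝ) → ℝ} (hf : ContDiff ℝ 1 f) (i : Fin d) :
    Continuous (pd i f) :=
  (hf.continuous_fderiv one_ne_zero).clm_apply continuous_const

theorem contDiff_pd {d : ℕ} {f : (Fin d → ℝ) → ℝ} (hf : ContDiff ℝ 2 f) (i : Fin d) :
    ContDiff ℝ 1 (pd i f) :=
  (hf.fderiv_right (m := 1) (by norm_num)).clm_apply contDiff_const

/-- The integral of a partial derivative of a periodic function over the unit cube vanishes. -/
theorem integral_fderiv_single_eq_zero {d : ℕ} {E : Type*} [NormedAddCommGroup E]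
    [NormedSpace ℝ E] {f : (Fin d → ℝ) → E} (hf : ContDiff ℝ 1 f)
    (hper : IsPeriodic f) (i : Fin d) :
    ∫ x in Icc (0 : Fin d → ℝ) 1, fderiv ℝ f x (Pi.single i 1) = 0 := by
  by_cases hE : CompleteSpace E
  swap
  · simp [integral, hE]
  obtain _ | n := d
  · exact i.elim0
  let F : Fin (n + 1) → (Fin (n + 1) → ℝ) → E := Pi.single i f
  let F' : Fin (n + 1) → (Fin (n + 1) → ℝ) → (Fin (n + 1) → ℝ) →L[ℝ] E :=
    Pi.single i (fderiv ℝ f)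
  have hsum : ∀ x, ∑ j, F' j x (Pi.single j 1) = fderiv ℝ f x (Pi.single i 1) := by
    intro x
    rw [Finset.sum_eq_single i]
    · simp [F']
    · intro j _ hj
      simp [F', Pi.single_eq_of_ne hj]
    · simp
  have hcont : Continuous fun x => fderiv ℝ f x (Pi.single i 1) :=
    (hf.continuous_fderiv one_ne_zero).clm_apply continuous_const
  have key := integral_divergence_of_hasFDerivAt_off_countable' (0 : Fin (n + 1) → ℝ) 1
    zero_le_one F F' ∅ countable_empty ?_ ?_ ?_
  · simp only [hsum] at key
    rw [key]
    refine Finset.sum_eq_zero fun j _ => ?_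
    obtain rfl | hj := eq_or_ne j i
    · rw [sub_eq_zero]
      congr 1
      ext x
      simp only [F, Pi.single_eq_same]
      rw [← hper (j.insertNth ((0 : Fin (n + 1) → ℝ) j) x) (Pi.single j 1)]
      congr 1
      ext l
      obtain rfl | ⟨m, rfl⟩ := Fin.eq_self_or_eq_succAbove j l
      · simp
      · simp
    · simp [F, Pi.single_eq_of_ne hj]
  · intro j
    obtain rfl | hj := eq_or_ne j i
    · simpa [F] using hf.continuous.continuousOn
    · simp only [F, Pi.single_eq_of_ne hj]
      exact continuousOn_const
  · intro x _ j
    obtain rfl | hj := eq_or_ne j i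
    · simpa [F, F'] using (hf.differentiable one_ne_zero x).hasFDerivAt
    · simp only [F, F', Pi.single_eq_of_ne hj]
      exact hasFDerivAt_const (0 : E) x
  · simp only [hsum]
    exact hcont.continuousOn.integrableOn_Icc

attribute [local instance] instMeasureSpaceUnitAddCircle

/-- The Fourier coefficients of a function on the unit cube. -/
noncomputable def cubeFourierCoeff {d : ℕ} (f : (Fin d → ℝ) → ℝ) (n : Fin d → ℤ) : ℂ :=
  ∫ x in Icc (0 : Fin d → ℝ) 1,
    UnitAddTorus.mFourier (-n) (fun i => (x i : UnitAddCircle)) * (f x : ℂ)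

theorem pi_Ioc_ae_eq_Icc {d : ℕ} :
    {x : Fin d → ℝ | ∀ i, x i ∈ Ioc ((0 : Fin d → ℝ) i) ((0 : Fin d → ℝ) i + 1)}
      =ᵐ[(volume : Measure (Fin d → ℝ))] Icc 0 1 := by
  have h : {x : Fin d → ℝ | ∀ i, x i ∈ Ioc ((0 : Fin d → ℝ) i) ((0 : Fin d → ℝ) i + 1)}
      = pi univ fun i => Ioc ((0 : Fin d → ℝ) i) ((1 : Fin d → ℝ) i) := by
    ext x; simp
  rw [h]
  exact Measure.univ_pi_Ioc_ae_eq_Icc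

local instance : IsProbabilityMeasure (volume : Measure UnitAddCircle) :=
  inferInstanceAs (IsProbabilityMeasure AddCircle.haarAddCircle)

/-- **Parseval's identity** for continuous periodic functions. -/
theorem hasSum_sq_cubeFourierCoeff {d : ℕ} {f : (Fin d → ℝ) → ℝ} (hf : Continuous f)
    (hper : IsPeriodic f) :
    HasSum (fun n => ‖cubeFourierCoeff f n‖ ^ 2) (∫ x in Icc (0 : Fin d → ℝ) 1, f x ^ 2) := by
  have hq : IsOpenQuotientMap (fun (x : Fin d → ℝ) i => (x i : UnitAddCircle)) :=
    IsOpenQuotientMap.piMap fun _ => QuotientAddGroup.isOpenQuotientMap_mk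
  let F : UnitAddTorus (Fin d) → ℂ := fun t => f fun i => AddCircle.equivIoc 1 0 (t i)
  have hF : ∀ x : Fin d → ℝ, F (fun i => (x i : UnitAddCircle)) = f x := by
    intro x
    have h : ∀ i, ∃ k : ℤ,
        ((AddCircle.equivIoc (1 : ℝ) 0 (x i : UnitAddCircle) : ℝ)) = x i + k := by
      intro i
      have h1 := AddCircle.coe_equivIoc (p := (1 : ℝ)) (a := 0) (y := (x i : UnitAddCircle))
      rw [← sub_eq_zero, ← AddCircle.coe_sub, AddCircle.coe_eq_zero_iff] at h1
      obtain ⟨k, hk⟩ := h1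
      refine ⟨k, ?_⟩
      simp only [zsmul_eq_mul, mul_one] at hk
      linarith
    choose k hk using h
    simp only [F, hk]
    exact congrArg _ (hper x k)
  have hFc : Continuous F := by
    rw [← hq.continuous_comp_iff]
    have : F ∘ (fun (x : Fin d → ℝ) i => (x i : UnitAddCircle)) = fun x => (f x : ℂ) :=
      funext hF
    rw [this]
    fun_prop
  let G : C(UnitAddTorus (Fin d), ℂ) := ⟨F, hFc⟩
  have key := UnitAddTorus.hasSum_sq_mFourierCoeff (ContinuousMap.toLp 2 volume ℂ G)
  have h1 : ∀ n, UnitAddTorus.mFourierCoeff (ContinuousMap.toLp 2 volume ℂ G) n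
      = cubeFourierCoeff f n := by
    intro n
    rw [UnitAddTorus.mFourierCoeff_toLp, UnitAddTorus.mFourierCoeff_eq_integral _ _ 0,
      setIntegral_congr_set pi_Ioc_ae_eq_Icc, cubeFourierCoeff]
    simp only [G, ContinuousMap.coe_mk, hF, smul_eq_mul]
  have h2 : ∫ t, ‖ContinuousMap.toLp 2 volume ℂ G t‖ ^ 2
      = ∫ x in Icc (0 : Fin d → ℝ) 1, f x ^ 2 := by
    trans ∫ t, ‖F t‖ ^ 2
    · refine integral_congr_ae ?_
      filter_upwards [ContinuousMap.coeFn_toLp (p := 2) (𝕜 := ℂ) volume G] with t ht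
      rw [ht]
      rfl
    · rw [UnitAddTorus.integral_preimage _ 0, setIntegral_congr_set pi_Ioc_ae_eq_Icc]
      simp [hF]
  simpa only [h1, h2] using key

theorem mFourier_coe_eq_exp {d : ℕ} (n : Fin d → ℤ) :
    (fun x : Fin d → ℝ => UnitAddTorus.mFourier n (fun i => (x i : UnitAddCircle)))
      = fun x => Complex.exp (2 * π * Complex.I * ∑ i, (n i : ℂ) * (x i : ℂ)) := by
  ext x
  simp only [UnitAddTorus.mFourier, ContinuousMap.coe_mk, fourier_coe_apply, Finset.mul_sum,
    Complex.exp_sum]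
  simp
  refine Finset.prod_congr rfl fun i _ => ?_
  ring_nf

theorem cubeFourierCoeff_pd {d : ℕ} {f : (Fin d → ℝ) → ℝ} (hf : ContDiff ℝ 1 f)
    (hper : IsPeriodic f) (i : Fin d) (n : Fin d → ℤ) :
    cubeFourierCoeff (pd i f) n = 2 * π * Complex.I * n i * cubeFourierCoeff f n := by
  let e : (Fin d → ℝ) → ℂ := fun x =>
    UnitAddTorus.mFourier (-n) (fun i => (x i : UnitAddCircle))
  have he : e = fun x => Complex.exp (2 * π * Complex.I *
      ∑ i, ((-n) i : ℂ) * (Complex.ofRealCLM.comp (ContinuousLinearMap.proj i)) x) := by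
    simpa [e] using mFourier_coe_eq_exp (-n)
  have hed : ∀ x, HasFDerivAt e (e x • ((2 * π * Complex.I) • ∑ i, ((-n) i : ℂ) •
      (Complex.ofRealCLM.comp (ContinuousLinearMap.proj (R := ℝ) (φ := fun _ : Fin d => ℝ) i)))) x := by
    intro x
    rw [he]
    refine HasFDerivAt.cexp ?_
    refine HasFDerivAt.const_mul ?_ _
    refine HasFDerivAt.fun_sum fun j _ => ?_
    exact (ContinuousLinearMap.hasFDerivAt _).const_mul _
  have hec : ContDiff ℝ 1 e := by
    rw [he]
    fun_prop
  have heper : IsPeriodic e := by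
    intro x k
    simp only [e]
    congr 1
    ext i
    simp only [Pi.add_apply, AddCircle.coe_add]
    simp
  have hfc : ContDiff ℝ 1 fun x => (f x : ℂ) := Complex.ofRealCLM.contDiff.comp hf
  have hfd : ∀ x, HasFDerivAt (fun x => (f x : ℂ)) (Complex.ofRealCLM.comp (fderiv ℝ f x)) x :=
    fun x => Complex.ofRealCLM.hasFDerivAt.comp x (hf.differentiable one_ne_zero x).hasFDerivAt
  have key := integral_fderiv_single_eq_zero (f := fun x => e x * (f x : ℂ)) (hec.mul hfc)
    (fun x k => by simp only [heper x k, hper x k]) i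
  have hD : ∀ x, fderiv ℝ (fun x => e x * (f x : ℂ)) x (Pi.single i 1)
      = e x * (pd i f x : ℂ) - (2 * π * Complex.I * n i) * (e x * (f x : ℂ)) := by
    intro x
    rw [((hed x).fun_mul (hfd x)).fderiv]
    have hs : ∑ j, (n j : ℂ) * ((Pi.single i (1 : ℝ) : Fin d → ℝ) j : ℂ) = n i := by
      rw [Finset.sum_eq_single i] <;> simp +contextual
    simp [pd, hs]
    ring
  simp only [hD] at key
  have hpc := continuous_pd hf i
  rw [integral_sub, integral_const_mul, sub_eq_zero] at key
  · exact key
  · exact (hec.continuous.mul (Complex.continuous_ofReal.comp hpc)).continuousOn.integrableOn_Icc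
  · exact (continuous_const.mul (hec.continuous.mul hfc.continuous)).continuousOn.integrableOn_Icc

theorem continuous_lap {d : ℕ} {f : (Fin d → ℝ) → ℝ} (hf : ContDiff ℝ 2 f) :
    Continuous (lap f) :=
  continuous_finsetSum _ fun i _ => continuous_pd (contDiff_pd hf i) i

theorem isPeriodic_lap {d : ℕ} {f : (Fin d → ℝ) → ℝ} (hper : IsPeriodic f) :
    IsPeriodic (lap f) := fun x k =>
  Finset.sum_congr rfl fun i _ => isPeriodic_pd (isPeriodic_pd hper i) i x k

theorem cubeFourierCoeff_pd_pd {d : ℕ} {f : (Fin d → ℝ) → ℝ} (hf : ContDiff ℝ 2 f)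
    (hper : IsPeriodic f) (i j : Fin d) (n : Fin d → ℤ) :
    cubeFourierCoeff (pd i (pd j f)) n
      = -((4 * π ^ 2 * (n i * n j) : ℝ) : ℂ) * cubeFourierCoeff f n := by
  rw [cubeFourierCoeff_pd (contDiff_pd hf j) (isPeriodic_pd hper j),
    cubeFourierCoeff_pd (hf.of_le one_le_two) hper]
  push_cast
  linear_combination 4 * π ^ 2 * n i * n j * cubeFourierCoeff f n * Complex.I_sq

theorem cubeFourierCoeff_lap {d : ℕ} {f : (Fin d → ℝ) → ℝ} (hf : ContDiff ℝ 2 f)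
    (hper : IsPeriodic f) (n : Fin d → ℤ) :
    cubeFourierCoeff (lap f) n
      = -((4 * π ^ 2 * ∑ i, (n i : ℝ) ^ 2 : ℝ) : ℂ) * cubeFourierCoeff f n := by
  have h : cubeFourierCoeff (lap f) n = ∑ i, cubeFourierCoeff (pd i (pd i f)) n := by
    simp only [cubeFourierCoeff, lap, Complex.ofReal_sum, Finset.mul_sum]
    refine integral_finsetSum _ fun i _ => Continuous.integrableOn_Icc ?_
    have := continuous_pd (contDiff_pd hf i) i
    refine Continuous.mul ?_ (Complex.continuous_ofReal.comp this)
    exact (ContinuousMap.continuous _).comp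
      (continuous_pi fun i => (AddCircle.continuous_mk' 1).comp (continuous_apply i))
  rw [h]
  simp only [cubeFourierCoeff_pd_pd hf hper]
  push_cast
  simp only [Finset.mul_sum, ← Finset.sum_neg_distrib, Finset.sum_mul]
  exact Finset.sum_congr rfl fun i _ => by ring

/-- The integrated flat Bochner identity. -/
theorem sum_integral_pd_pd_sq {d : ℕ} {f : (Fin d → ℝ) → ℝ} (hf : ContDiff ℝ 2 f)
    (hper : IsPeriodic f) :
    ∑ i, ∑ j, ∫ x in Icc (0 : Fin d → ℝ) 1, pd i (pd j f) x ^ 2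
      = ∫ x in Icc (0 : Fin d → ℝ) 1, lap f x ^ 2 := by
  have h1 := hasSum_sum (s := Finset.univ) fun i _ => hasSum_sum (s := Finset.univ) fun j _ =>
    hasSum_sq_cubeFourierCoeff (continuous_pd (contDiff_pd hf j) i)
      (isPeriodic_pd (isPeriodic_pd hper j) i)
  refine h1.unique ?_
  convert hasSum_sq_cubeFourierCoeff (continuous_lap hf) (isPeriodic_lap hper) using 2 with n
  simp only [cubeFourierCoeff_pd_pd hf hper, cubeFourierCoeff_lap hf hper, norm_mul, norm_neg,
    Complex.norm_real, mul_pow, Real.norm_eq_abs, sq_abs]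
  rw [sq (∑ i, (n i : ℝ) ^ 2), Finset.sum_mul_sum]
  simp only [Finset.mul_sum, Finset.sum_mul]

/-- Poincaré's inequality for the gradient of a periodic function. -/
theorem sum_integral_pd_sq_le {d : ℕ} {f : (Fin d → ℝ) → ℝ} (hf : ContDiff ℝ 2 f)
    (hper : IsPeriodic f) :
    4 * π ^ 2 * ∑ i, ∫ x in Icc (0 : Fin d → ℝ) 1, pd i f x ^ 2
      ≤ ∫ x in Icc (0 : Fin d → ℝ) 1, lap f x ^ 2 := by
  have h1 := (hasSum_sum (s := Finset.univ) fun i _ =>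
    hasSum_sq_cubeFourierCoeff (continuous_pd (hf.of_le one_le_two) i)
      (isPeriodic_pd hper i)).mul_left (4 * π ^ 2)
  refine hasSum_le (fun n => ?_) h1
    (hasSum_sq_cubeFourierCoeff (continuous_lap hf) (isPeriodic_lap hper))
  have hN : ∑ i, (n i : ℝ) ^ 2 ≤ (∑ i, (n i : ℝ) ^ 2) ^ 2 := by
    have : ∑ i, (n i : ℝ) ^ 2 = ((∑ i, n i ^ 2 : ℤ) : ℝ) := by push_cast; rfl
    rw [this]
    exact_mod_cast Int.le_self_sq _
  simp only [cubeFourierCoeff_pd (hf.of_le one_le_two) hper, cubeFourierCoeff_lap hf hper,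
    norm_mul, norm_neg, Complex.norm_real, mul_pow, Real.norm_eq_abs, sq_abs, Complex.norm_I,
    Complex.norm_intCast, mul_one, Complex.norm_ofNat, ← Finset.sum_mul, ← Finset.mul_sum]
  have : 0 ≤ (4 * π ^ 2) ^ 2 * ‖cubeFourierCoeff f n‖ ^ 2 := by positivity
  nlinarith [mul_le_mul_of_nonneg_left hN this]

theorem pd_mul {d : ℕ} {f g : (Fin d → ℝ) → ℝ} (hf : ContDiff ℝ 1 f) (hg : ContDiff ℝ 1 g)
    (i : Fin d) (x : Fin d → ℝ) :
    pd i (fun y => f y * g y) x = pd i f x * g x + f x * pd i g x := by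
  have h := (hf.differentiable one_ne_zero x).hasFDerivAt.fun_mul
    (hg.differentiable one_ne_zero x).hasFDerivAt
  simp only [pd, h.fderiv, _root_.add_apply, _root_.smul_apply,
    smul_eq_mul]
  ring

theorem pd_rpow {d : ℕ} {f : (Fin d → ℝ) → ℝ} (hf : ContDiff ℝ 1 f) (hpos : ∀ x, 0 < f x)
    (a : ℝ) (i : Fin d) (x : Fin d → ℝ) :
    pd i (fun y => f y ^ a) x = a * f x ^ (a - 1) * pd i f x := by
  have h := (hf.differentiable one_ne_zero x).hasFDerivAt.rpow_const (p := a)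
    (Or.inl (hpos x).ne')
  simp [pd, h.fderiv]

theorem pd_finset_sum {d : ℕ} {ι : Type*} (s : Finset ι) {f : ι → (Fin d → ℝ) → ℝ}
    (hf : ∀ j, ContDiff ℝ 1 (f j)) (i : Fin d) (x : Fin d → ℝ) :
    pd i (fun y => ∑ j ∈ s, f j y) x = ∑ j ∈ s, pd i (f j) x := by
  have h := HasFDerivAt.fun_sum (u := s) fun j _ =>
    ((hf j).differentiable one_ne_zero x).hasFDerivAt
  simp [pd, h.fderiv]

/-- The squared norm of the gradient. -/
noncomputable def gradSq {d : ℕ} (f : (Fin d → ℝ) → ℝ) (x : Fin d → ℝ) : ℝ :=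
  ∑ i, pd i f x ^ 2

theorem contDiff_gradSq {d : ℕ} {f : (Fin d → ℝ) → ℝ} (hf : ContDiff ℝ 2 f) :
    ContDiff ℝ 1 (gradSq f) :=
  ContDiff.sum fun i _ => (contDiff_pd hf i).pow 2

theorem isPeriodic_gradSq {d : ℕ} {f : (Fin d → ℝ) → ℝ} (hper : IsPeriodic f) :
    IsPeriodic (gradSq f) := fun x k =>
  Finset.sum_congr rfl fun i _ => by rw [isPeriodic_pd hper i x k]

theorem pd_gradSq {d : ℕ} {f : (Fin d → ℝ) → ℝ} (hf : ContDiff ℝ 2 f) (i : Fin d)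
    (x : Fin d → ℝ) : pd i (gradSq f) x = 2 * ∑ j, pd j f x * pd i (pd j f) x := by
  have h : gradSq f = fun y => ∑ j, pd j f y * pd j f y := by
    ext y
    simp only [gradSq, sq]
  rw [h, pd_finset_sum _ fun j => (contDiff_pd hf j).mul (contDiff_pd hf j), Finset.mul_sum]
  refine Finset.sum_congr rfl fun j _ => ?_
  rw [pd_mul (contDiff_pd hf j) (contDiff_pd hf j)]
  ring

theorem lap_rpow {d : ℕ} {f : (Fin d → ℝ) → ℝ} (hf : ContDiff ℝ 2 f) (hpos : ∀ x, 0 < f x)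
    (a : ℝ) (x : Fin d → ℝ) :
    lap (fun y => f y ^ a) x
      = a * f x ^ (a - 1) * (lap f x + (a - 1) * (gradSq f x / f x)) := by
  have hf1 : ContDiff ℝ 1 f := hf.of_le one_le_two
  have h : ∀ i, pd i (fun y => f y ^ a) = fun y => (a * f y ^ (a - 1)) * pd i f y :=
    fun i => funext fun y => pd_rpow hf1 hpos a i y
  have hr : ContDiff ℝ 1 fun y => f y ^ (a - 1) := hf1.rpow_const_of_ne fun y => (hpos y).ne'
  have h2 : ∀ i, pd i (pd i fun y => f y ^ a) x
      = a * f x ^ (a - 1) * (pd i (pd i f) x + (a - 1) * (pd i f x ^ 2 / f x)) := by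
    intro i
    rw [h, pd_mul (contDiff_const.mul hr) (contDiff_pd hf i), pd_mul contDiff_const hr,
      pd_rpow hf1 hpos, Real.rpow_sub_one (hpos x).ne' (a - 1)]
    have h0 : pd i (fun _ : Fin d → ℝ => a) x = 0 := by simp [pd]
    rw [h0]
    ring
  simp only [lap, h2, gradSq, Finset.sum_div, Finset.mul_sum, Finset.sum_add_distrib, mul_add]

/-- Green's formula on the torus. -/
theorem integral_mul_lap {d : ℕ} {w f : (Fin d → ℝ) → ℝ} (hw : ContDiff ℝ 1 w)
    (hwper : IsPeriodic w) (hf : ContDiff ℝ 2 f) (hper : IsPeriodic f) :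
    ∫ x in Icc (0 : Fin d → ℝ) 1, w x * lap f x
      = -∫ x in Icc (0 : Fin d → ℝ) 1, ∑ i, pd i w x * pd i f x := by
  have h1 : ∀ i, ∫ x in Icc (0 : Fin d → ℝ) 1, pd i (fun y => w y * pd i f y) x = 0 := fun i =>
    integral_fderiv_single_eq_zero (hw.mul (contDiff_pd hf i))
      (fun x k => by simp only [hwper x k, isPeriodic_pd hper i x k]) i
  have hc1 : ∀ i, Continuous fun x => pd i w x * pd i f x := fun i =>
    (continuous_pd hw i).mul (contDiff_pd hf i).continuous
  have hc3 : Continuous fun x => w x * lap f x := hw.continuous.mul (continuous_lap hf)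
  rw [eq_neg_iff_add_eq_zero, ← integral_add hc3.integrableOn_Icc
    (continuous_finsetSum _ fun i _ => hc1 i).integrableOn_Icc]
  trans ∑ i, ∫ x in Icc (0 : Fin d → ℝ) 1, pd i (fun y => w y * pd i f y) x
  · rw [← integral_finsetSum]
    · refine integral_congr_ae (Filter.Eventually.of_forall fun x => ?_)
      simp only [lap, pd_mul hw (contDiff_pd hf _), Finset.mul_sum, ← Finset.sum_add_distrib]
      exact Finset.sum_congr rfl fun i _ => add_comm _ _
    · intro i _
      exact (continuous_pd (hw.mul (contDiff_pd hf i)) i).integrableOn_Icc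
  · exact Finset.sum_eq_zero fun i _ => h1 i

theorem integral_rpow_mul_lap {d : ℕ} {u : (Fin d → ℝ) → ℝ} (hu : ContDiff ℝ 2 u)
    (hper : IsPeriodic u) (hpos : ∀ x, 0 < u x) (κ : ℝ) :
    ∫ x in Icc (0 : Fin d → ℝ) 1, u x ^ κ * lap u x
      = -(κ * ∫ x in Icc (0 : Fin d → ℝ) 1, u x ^ (κ - 1) * gradSq u x) := by
  have hu1 : ContDiff ℝ 1 u := hu.of_le one_le_two
  rw [integral_mul_lap (hu1.rpow_const_of_ne fun y => (hpos y).ne')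
    (fun x k => by simp only [hper x k]) hu hper, ← integral_const_mul]
  congr 2
  ext x
  simp only [pd_rpow hu1 hpos, gradSq, Finset.mul_sum]
  exact Finset.sum_congr rfl fun i _ => by ring

theorem integral_gradSq_div_mul_lap {d : ℕ} {u : (Fin d → ℝ) → ℝ} (hu : ContDiff ℝ 2 u)
    (hper : IsPeriodic u) (hpos : ∀ x, 0 < u x) :
    ∫ x in Icc (0 : Fin d → ℝ) 1, gradSq u x / u x * lap u x
      = (∫ x in Icc (0 : Fin d → ℝ) 1, (gradSq u x / u x) ^ 2)
        - 2 * ∫ x in Icc (0 : Fin d → ℝ) 1,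
          ∑ i, ∑ j, pd i (pd j u) x * (pd i u x * pd j u x / u x) := by
  have hu1 : ContDiff ℝ 1 u := hu.of_le one_le_two
  have hinv : ContDiff ℝ 1 fun x => u x ^ (-1 : ℝ) :=
    hu1.rpow_const_of_ne fun y => (hpos y).ne'
  have hg := contDiff_gradSq hu
  have hdiv : ∀ x, gradSq u x / u x = gradSq u x * u x ^ (-1 : ℝ) := fun x => by
    rw [Real.rpow_neg_one, div_eq_mul_inv]
  have hpd := fun i => contDiff_pd hu i
  have hpd2 := fun i j => continuous_pd (hpd j) i
  have hui : Continuous fun x => (u x)⁻¹ := hu.continuous.inv₀ fun x => (hpos x).ne'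
  have hc1 : Continuous fun x => (gradSq u x / u x) ^ 2 :=
    (hg.continuous.mul hui).pow 2
  have hc2 : Continuous fun x => ∑ i, ∑ j, pd i (pd j u) x * (pd i u x * pd j u x / u x) :=
    continuous_finsetSum _ fun i _ => continuous_finsetSum _ fun j _ =>
      (hpd2 i j).mul (((hpd i).continuous.mul (hpd j).continuous).mul hui)
  rw [← integral_const_mul, ← integral_sub hc1.integrableOn_Icc
    (hc2.integrableOn_Icc.const_mul 2)]
  have key := integral_mul_lap (hg.mul hinv)
    (fun x k => by simp only [hper x k, isPeriodic_gradSq hper x k]) hu hper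
  simp only [← hdiv] at key
  rw [key, ← integral_neg]
  congr 2
  ext x
  have h2 : u x ^ (-1 - 1 : ℝ) = (u x ^ 2)⁻¹ := by
    rw [show (-1 - 1 : ℝ) = -(2 : ℕ) by norm_num, Real.rpow_neg (hpos x).le, Real.rpow_natCast]
  have h3 : ∀ i, pd i (fun y => gradSq u y * u y ^ (-1 : ℝ)) x * pd i u x
      = 2 * ∑ j, pd i (pd j u) x * (pd i u x * pd j u x / u x)
        - gradSq u x / u x ^ 2 * pd i u x ^ 2 := by
    intro i
    rw [pd_mul hg hinv, pd_gradSq hu, pd_rpow hu1 hpos, h2, Real.rpow_neg_one]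
    have : ∑ j, pd i (pd j u) x * (pd i u x * pd j u x / u x)
        = (∑ j, pd j u x * pd i (pd j u) x) * (u x)⁻¹ * pd i u x := by
      rw [Finset.sum_mul, Finset.sum_mul]
      exact Finset.sum_congr rfl fun j _ => by ring
    rw [this]
    ring
  simp only [hdiv] at h3 ⊢
  simp only [h3, Finset.sum_sub_distrib, ← Finset.mul_sum]
  rw [← gradSq, Real.rpow_neg_one]
  ring

theorem continuous_hess_contraction {d : ℕ} {u : (Fin d → ℝ) → ℝ} (hu : ContDiff ℝ 2 u)
    (hpos : ∀ x, 0 < u x) :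
    Continuous fun x => ∑ i, ∑ j, pd i (pd j u) x * (pd i u x * pd j u x / u x) :=
  continuous_finsetSum _ fun i _ => continuous_finsetSum _ fun j _ =>
    (continuous_pd (contDiff_pd hu j) i).mul
      (((contDiff_pd hu i).continuous.mul (contDiff_pd hu j).continuous).div hu.continuous
        fun x => (hpos x).ne')

theorem trace_sub_sq_le {d : ℕ} (h : Fin d → Fin d → ℝ) (g : Fin d → ℝ) (r t : ℝ) :
    (∑ i, h i i - t * ((∑ i, g i ^ 2) / r)) ^ 2
      ≤ d * (∑ i, ∑ j, h i j ^ 2 - 2 * t * ∑ i, ∑ j, h i j * (g i * g j / r)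
        + t ^ 2 * ((∑ i, g i ^ 2) / r) ^ 2) := by
  have h1 : ∑ i, h i i - t * ((∑ i, g i ^ 2) / r) = ∑ i, (h i i - t * (g i * g i / r)) := by
    rw [Finset.sum_sub_distrib, Finset.sum_div, Finset.mul_sum]
    exact congrArg _ (Finset.sum_congr rfl fun i _ => by ring)
  have h2 : ∑ i, ∑ j, h i j ^ 2 - 2 * t * ∑ i, ∑ j, h i j * (g i * g j / r)
        + t ^ 2 * ((∑ i, g i ^ 2) / r) ^ 2
      = ∑ i, ∑ j, (h i j - t * (g i * g j / r)) ^ 2 := by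
    rw [div_pow, sq (∑ i, g i ^ 2), Finset.sum_mul_sum]
    simp only [Finset.mul_sum, Finset.sum_div, ← Finset.sum_sub_distrib, ← Finset.sum_add_distrib]
    exact Finset.sum_congr rfl fun i _ => Finset.sum_congr rfl fun j _ => by ring
  rw [h1, h2]
  calc (∑ i, (h i i - t * (g i * g i / r))) ^ 2
      ≤ d * ∑ i, (h i i - t * (g i * g i / r)) ^ 2 := by
        simpa using sq_sum_le_card_mul_sum_sq (s := Finset.univ)
          (f := fun i => h i i - t * (g i * g i / r))
    _ ≤ d * ∑ i, ∑ j, (h i j - t * (g i * g j / r)) ^ 2 := by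
        gcongr with i
        exact Finset.single_le_sum (f := fun j => (h i j - t * (g i * g j / r)) ^ 2)
          (fun j _ => sq_nonneg _) (Finset.mem_univ i)

/-- The integrated trace inequality for the symmetric tensor `D²u - t ∇u ⊗ ∇u / u`. -/
theorem integral_trace_sq_le {d : ℕ} {u : (Fin d → ℝ) → ℝ} (hu : ContDiff ℝ 2 u)
    (hper : IsPeriodic u) (hpos : ∀ x, 0 < u x) (t : ℝ) :
    (∫ x in Icc (0 : Fin d → ℝ) 1, lap u x ^ 2)
        - 2 * t * (∫ x in Icc (0 : Fin d → ℝ) 1, gradSq u x / u x * lap u x)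
        + t ^ 2 * (∫ x in Icc (0 : Fin d → ℝ) 1, (gradSq u x / u x) ^ 2)
      ≤ d * ((∫ x in Icc (0 : Fin d → ℝ) 1, lap u x ^ 2)
        - 2 * t * (∫ x in Icc (0 : Fin d → ℝ) 1,
          ∑ i, ∑ j, pd i (pd j u) x * (pd i u x * pd j u x / u x))
        + t ^ 2 * (∫ x in Icc (0 : Fin d → ℝ) 1, (gradSq u x / u x) ^ 2)) := by
  have hG : Continuous fun x => gradSq u x / u x :=
    (contDiff_gradSq hu).continuous.div hu.continuous fun x => (hpos x).ne'
  have hL := continuous_lap hu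
  have iA : IntegrableOn (fun x => lap u x ^ 2) (Icc 0 1) := (hL.pow 2).integrableOn_Icc
  have iB : IntegrableOn (fun x => gradSq u x / u x * lap u x) (Icc 0 1) :=
    (hG.mul hL).integrableOn_Icc
  have iC : IntegrableOn (fun x => (gradSq u x / u x) ^ 2) (Icc 0 1) := (hG.pow 2).integrableOn_Icc
  have iD := (continuous_hess_contraction hu hpos).integrableOn_Icc (μ := volume) (a := 0) (b := 1)
  have iHij : ∀ i j, IntegrableOn (fun x => pd i (pd j u) x ^ 2) (Icc 0 1) := fun i j =>
    ((continuous_pd (contDiff_pd hu j) i).pow 2).integrableOn_Icc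
  have iH : IntegrableOn (fun x => ∑ i, ∑ j, pd i (pd j u) x ^ 2) (Icc 0 1) :=
    integrable_finsetSum _ fun i _ => integrable_finsetSum _ fun j _ => iHij i j
  have hH : ∫ x in Icc (0 : Fin d → ℝ) 1, lap u x ^ 2
      = ∫ x in Icc (0 : Fin d → ℝ) 1, ∑ i, ∑ j, pd i (pd j u) x ^ 2 := by
    rw [← sum_integral_pd_pd_sq hu hper, integral_finsetSum _ fun i _ =>
      integrable_finsetSum _ fun j _ => iHij i j]
    exact Finset.sum_congr rfl fun i _ => (integral_finsetSum _ fun j _ => iHij i j).symm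
  have key := setIntegral_mono
    ((iA.sub (iB.const_mul (2 * t))).add (iC.const_mul (t ^ 2)))
    (((iH.sub (iD.const_mul (2 * t))).add (iC.const_mul (t ^ 2))).const_mul (d : ℝ))
    fun x => by
      have := trace_sub_sq_le (fun i j => pd i (pd j u) x) (fun i => pd i u x) (u x) t
      refine le_trans (le_of_eq ?_) this
      simp only [Pi.add_apply, Pi.sub_apply, lap, gradSq]
      ring
  simp only [Pi.add_apply, Pi.sub_apply] at key
  have e1 := integral_add (iA.sub (iB.const_mul (2 * t))) (iC.const_mul (t ^ 2))
  have e2 := integral_add (iH.sub (iD.const_mul (2 * t))) (iC.const_mul (t ^ 2))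
  simp only [Pi.sub_apply] at e1 e2
  rw [integral_const_mul, e1, e2, integral_sub iA (iB.const_mul (2 * t)),
    integral_sub iH (iD.const_mul (2 * t)), integral_const_mul, integral_const_mul,
    integral_const_mul, ← hH] at key
  exact key

/-- The identity obtained by testing the equation of `u` with `Δu + κ |∇u|² / u`. -/
theorem integral_equation_identity {d : ℕ} {u : (Fin d → ℝ) → ℝ} (hu : ContDiff ℝ 2 u)
    (hper : IsPeriodic u) (hpos : ∀ x, 0 < u x) (β κ c : ℝ)
    (heq : ∀ x, lap u x + (β - 1) * (gradSq u x / u x) + c * (u x ^ κ - u x) = 0) :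
    (∫ x in Icc (0 : Fin d → ℝ) 1, lap u x ^ 2)
        + (κ + β - 1) * (∫ x in Icc (0 : Fin d → ℝ) 1, gradSq u x / u x * lap u x)
        + κ * (β - 1) * (∫ x in Icc (0 : Fin d → ℝ) 1, (gradSq u x / u x) ^ 2)
      = c * (κ - 1) * ∫ x in Icc (0 : Fin d → ℝ) 1, gradSq u x := by
  have hg := (contDiff_gradSq hu).continuous
  have hG : Continuous fun x => gradSq u x / u x :=
    hg.div hu.continuous fun x => (hpos x).ne'
  have hL := continuous_lap hu
  have hr : ∀ a : ℝ, Continuous fun x => u x ^ a := fun a =>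
    hu.continuous.rpow_const fun x => Or.inl (hpos x).ne'
  have iA : IntegrableOn (fun x => lap u x ^ 2) (Icc 0 1) := (hL.pow 2).integrableOn_Icc
  have iB : IntegrableOn (fun x => gradSq u x / u x * lap u x) (Icc 0 1) :=
    (hG.mul hL).integrableOn_Icc
  have iC : IntegrableOn (fun x => (gradSq u x / u x) ^ 2) (Icc 0 1) := (hG.pow 2).integrableOn_Icc
  have iP : IntegrableOn (fun x => u x ^ κ * lap u x) (Icc 0 1) := ((hr κ).mul hL).integrableOn_Icc
  have iQ : IntegrableOn (fun x => u x * lap u x) (Icc 0 1) :=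
    (hu.continuous.mul hL).integrableOn_Icc
  have iN : IntegrableOn (fun x => u x ^ (κ - 1) * gradSq u x) (Icc 0 1) :=
    ((hr (κ - 1)).mul hg).integrableOn_Icc
  have iE : IntegrableOn (fun x => gradSq u x) (Icc 0 1) := hg.integrableOn_Icc
  have hP := integral_rpow_mul_lap hu hper hpos κ
  have hQ := integral_rpow_mul_lap hu hper hpos 1
  simp only [Real.rpow_one, sub_self, Real.rpow_zero, one_mul] at hQ
  have hpt : ∀ x, lap u x ^ 2 + (κ + β - 1) * (gradSq u x / u x * lap u x)
      + κ * (β - 1) * (gradSq u x / u x) ^ 2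
      = c * (u x * lap u x - u x ^ κ * lap u x)
        + c * κ * (gradSq u x - u x ^ (κ - 1) * gradSq u x) := by
    intro x
    have h1 : gradSq u x / u x * u x = gradSq u x := div_mul_cancel₀ _ (hpos x).ne'
    have h2 : gradSq u x / u x * u x ^ κ = u x ^ (κ - 1) * gradSq u x := by
      rw [Real.rpow_sub_one (hpos x).ne']
      ring
    linear_combination (lap u x + κ * (gradSq u x / u x)) * heq x + c * κ * h1 - c * κ * h2
  have key := congrArg (fun F => ∫ x in Icc (0 : Fin d → ℝ) 1, F x) (funext hpt)
  simp only at key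
  have e1 := integral_add (iA.add (iB.const_mul (κ + β - 1))) (iC.const_mul (κ * (β - 1)))
  have e2 := integral_add ((iQ.sub iP).const_mul c) ((iE.sub iN).const_mul (c * κ))
  simp only [Pi.add_apply, Pi.sub_apply] at e1 e2
  rw [e1, e2, integral_add iA (iB.const_mul _), integral_const_mul, integral_const_mul,
    integral_const_mul, integral_const_mul, integral_sub iQ iP, integral_sub iE iN, hP, hQ] at key
  rw [key]
  ring

theorem gradSq_eq_zero_of_integral_le {d : ℕ} {u : (Fin d → ℝ) → ℝ} (hu : ContDiff ℝ 2 u)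
    (hper : IsPeriodic u) (h : ∫ x in Icc (0 : Fin d → ℝ) 1, gradSq u x ≤ 0) (x : Fin d → ℝ) :
    gradSq u x = 0 := by
  have hg := (contDiff_gradSq hu).continuous
  have hnn : ∀ x, 0 ≤ gradSq u x := fun x => Finset.sum_nonneg fun i _ => sq_nonneg _
  have h0 : ∫ x in Icc (0 : Fin d → ℝ) 1, gradSq u x = 0 :=
    le_antisymm h (integral_nonneg hnn)
  rw [integral_eq_zero_iff_of_nonneg hnn hg.integrableOn_Icc] at h0
  have hcl : Icc (0 : Fin d → ℝ) 1 ⊆ closure (interior (Icc 0 1)) := by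
    rw [← pi_univ_Icc, interior_pi_set finite_univ, closure_pi_set]
    simp [interior_Icc, closure_Ioo]
  have h1 := Measure.eqOn_of_ae_eq h0 hg.continuousOn continuousOn_const hcl
  have hx := isPeriodic_gradSq hper (fun i => Int.fract (x i)) fun i => ⌊x i⌋
  have hsplit : ((fun i => Int.fract (x i)) + fun i => (⌊x i⌋ : ℝ)) = x :=
    funext fun i => Int.fract_add_floor (x i)
  rw [hsplit] at hx
  rw [hx]
  exact h1 ⟨fun i => Int.fract_nonneg _, fun i => (Int.fract_lt_one _).le⟩

/-- The exponent `β = (d + 2) / (d + 3 - p)` turns the quadratic form into a perfect square. -/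
theorem energy_nonpos {d p θ lam A B C D E : ℝ} (hd : 2 ≤ d) (hp : 1 < p)
    (hβ : d + 3 - p ≠ 0) (hθ : θ = (d - 1) ^ 2 * (p - 1) / (d * (d + 2) + p - 1))
    (hlam0 : 0 < lam) (hlam1 : lam < (1 - θ) * (4 * π ^ 2))
    (hB : B = C - 2 * D) (hA : 4 * π ^ 2 * E ≤ A)
    (hsq : ∀ t : ℝ, A - 2 * t * B + t ^ 2 * C ≤ d * (A - 2 * t * D + t ^ 2 * C))
    (hid : A + (d + 2) / (d + 3 - p) * (p - 1) * B
      + ((d + 2) / (d + 3 - p) * (p - 2) + 1) * ((d + 2) / (d + 3 - p) - 1) * C = lam * E) :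
    E ≤ 0 := by
  have hden : 0 < d * (d + 2) + p - 1 := by nlinarith
  have hd1 : 0 < d - 1 := by linarith
  have hd2 : 0 < d + 2 := by linarith
  have hθ0 : 0 < θ := by
    rw [hθ]
    have : 0 < p - 1 := by linarith
    positivity
  have hθ1 : 0 < 1 - θ := by
    by_contra! h
    nlinarith [mul_nonpos_of_nonpos_of_nonneg h (by positivity : 0 ≤ 4 * π ^ 2)]
  set t : ℝ := (d * (d + 2) + p - 1) / ((d - 1) * (d + 3 - p)) with ht
  have h1 : 0 ≤ (d - 1) * A + t * (d + 2) * B + ((d - 1) * t ^ 2 - d * t) * C := by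
    have := hsq t
    rw [show 2 * t * D = t * (C - B) by rw [hB]; ring] at this
    linarith
  have h2 : θ / (d - 1) * (t * (d + 2)) = (d + 2) / (d + 3 - p) * (p - 1) := by
    rw [hθ, ht]
    field_simp
  have h3 : θ / (d - 1) * ((d - 1) * t ^ 2 - d * t)
      = ((d + 2) / (d + 3 - p) * (p - 2) + 1) * ((d + 2) / (d + 3 - p) - 1) := by
    rw [hθ, ht]
    field_simp
    ring
  have h4 : θ / (d - 1) * (d - 1) = θ := div_mul_cancel₀ _ hd1.ne'
  have h5 : 0 ≤ θ * A + (d + 2) / (d + 3 - p) * (p - 1) * B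
      + ((d + 2) / (d + 3 - p) * (p - 2) + 1) * ((d + 2) / (d + 3 - p) - 1) * C := by
    have := mul_nonneg (div_pos hθ0 hd1).le h1
    rw [← h2, ← h3]
    nth_rewrite 1 [← h4]
    linarith
  have h6 := mul_le_mul_of_nonneg_left hA hθ1.le
  have h7 : 0 ≤ (lam - (1 - θ) * (4 * π ^ 2)) * E := by linarith
  by_contra! h
  nlinarith

/-- Rigidity on the flat torus ℝ^d/ℤ^d: with θ = (d−1)²(p−1)/(d(d+2)+p−1) and
0 < λ < (1−θ)·4π², any positive C² ℤ^d-periodic solution of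
−Δv + (λ/(p−2))(v − v^{p−1}) = 0 is identically 1. -/
theorem rigidity_flat_torus (d : ℕ) (hd : 2 ≤ d) (p : ℝ)
    (hp : (3 ≤ d ∧ (p ∈ Set.Ioo 1 2 ∪ Set.Ioo 2 (2 * (d : ℝ) / ((d : ℝ) - 2))))
        ∨ (d = 2 ∧ (p ∈ Set.Ioo 1 2 ∪ Set.Ioo 2 5 ∪ Set.Ioi 5)))
    (θ : ℝ) (hθ : θ = ((d : ℝ) - 1) ^ 2 * (p - 1) / ((d : ℝ) * ((d : ℝ) + 2) + p - 1))
    (lam : ℝ) (hlam0 : 0 < lam) (hlam1 : lam < (1 - θ) * (4 * π ^ 2))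
    (v : (Fin d → ℝ) → ℝ) (hv : ContDiff ℝ 2 v)
    (hper : ∀ (x : Fin d → ℝ) (k : Fin d → ℤ), v (x + fun i => (k i : ℝ)) = v x)
    (hpos : ∀ x, 0 < v x)
    (heq : ∀ x : Fin d → ℝ,
      - lap v x + (lam / (p - 2)) * (v x - v x ^ (p - 1)) = 0) :
    ∀ x : Fin d → ℝ, v x = 1 := by
  have hp1 : 1 < p := by
    rcases hp with ⟨_, h | h⟩ | ⟨_, (h | h) | h⟩
    · exact h.1
    · exact one_lt_two.trans h.1
    · exact h.1
    · exact one_lt_two.trans h.1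
    · exact lt_trans (by norm_num) h
  have hp2 : p - 2 ≠ 0 := by
    rcases hp with ⟨_, h | h⟩ | ⟨_, (h | h) | h⟩
    · exact (sub_neg.2 h.2).ne
    · exact (sub_pos.2 h.1).ne'
    · exact (sub_neg.2 h.2).ne
    · exact (sub_pos.2 h.1).ne'
    · exact (sub_pos.2 (lt_trans (by norm_num) h)).ne'
  have hβ0 : (d : ℝ) + 3 - p ≠ 0 := by
    rcases hp with ⟨hd3, h⟩ | ⟨rfl, h⟩
    · have hd3' : (3 : ℝ) ≤ d := by exact_mod_cast hd3
      have hlt : p < d + 3 := by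
        rcases h with h | h
        · linarith [h.2]
        · refine h.2.trans_le ?_
          rw [div_le_iff₀ (by linarith)]
          nlinarith
      linarith
    · rcases h with (h | h) | h
      · have := h.2
        push_cast
        linarith
      · have := h.2
        push_cast
        linarith
      · have : 5 < p := h
        push_cast
        linarith
  have hd' : (2 : ℝ) ≤ d := by exact_mod_cast hd
  set β : ℝ := (d + 2) / (d + 3 - p) with hβ
  have hβne : β ≠ 0 := div_ne_zero (by linarith) hβ0
  let u : (Fin d → ℝ) → ℝ := fun x => v x ^ β⁻¹
  have hupos : ∀ x, 0 < u x := fun x => Real.rpow_pos_of_pos (hpos x) _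
  have hu : ContDiff ℝ 2 u := hv.rpow_const_of_ne fun x => (hpos x).ne'
  have huper : IsPeriodic u := fun x k => by simp only [u, hper x k]
  have hvu : v = fun x => u x ^ β := funext fun x => by
    simp only [u]
    rw [← Real.rpow_mul (hpos x).le, inv_mul_cancel₀ hβne, Real.rpow_one]
  have hlap : ∀ x, lap v x
      = β * u x ^ (β - 1) * (lap u x + (β - 1) * (gradSq u x / u x)) := fun x => by
    conv_lhs => rw [hvu]
    exact lap_rpow hu hupos β x
  have hequ : ∀ x, lap u x + (β - 1) * (gradSq u x / u x)
      + lam / (p - 2) / β * (u x ^ (β * (p - 2) + 1) - u x) = 0 := by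
    intro x
    have h := heq x
    have h1 : v x = u x ^ (β - 1) * u x := by
      rw [← Real.rpow_add_one (hupos x).ne', sub_add_cancel]
      exact congrFun hvu x
    have h2 : v x ^ (p - 1) = u x ^ (β - 1) * u x ^ (β * (p - 2) + 1) := by
      rw [← Real.rpow_add (hupos x), congrFun hvu x, ← Real.rpow_mul (hupos x).le]
      congr 1
      ring
    rw [hlap, h2, h1] at h
    have h3 : u x ^ (β - 1) ≠ 0 := (Real.rpow_pos_of_pos (hupos x) _).ne'
    refine (mul_eq_zero.1 (?_ : (-(β * u x ^ (β - 1))) * _ = 0)).resolve_left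
      (neg_ne_zero.2 (mul_ne_zero hβne h3))
    have h4 : β * (lam / (p - 2) / β) = lam / (p - 2) := mul_div_cancel₀ _ hβne
    linear_combination h - u x ^ (β - 1) * (u x ^ (β * (p - 2) + 1) - u x) * h4
  have hid := integral_equation_identity hu huper hupos β (β * (p - 2) + 1) _ hequ
  have hpoinc := sum_integral_pd_sq_le hu huper
  have hE : ∑ i, ∫ x in Icc (0 : Fin d → ℝ) 1, pd i u x ^ 2
      = ∫ x in Icc (0 : Fin d → ℝ) 1, gradSq u x :=
    (integral_finsetSum _ fun i _ => ((contDiff_pd hu i).continuous.pow 2).integrableOn_Icc).symm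
  rw [hE] at hpoinc
  have hint := energy_nonpos hd' hp1 hβ0 hθ hlam0 hlam1
    (integral_gradSq_div_mul_lap hu huper hupos) hpoinc (integral_trace_sq_le hu huper hupos) (by
      rw [← hβ]
      convert hid using 2
      · ring
      · field_simp
        ring)
  have hgrad := gradSq_eq_zero_of_integral_le hu huper hint
  have hpd : ∀ i, pd i u = fun _ => 0 := fun i => funext fun x => by
    have h := (Finset.sum_eq_zero_iff_of_nonneg fun i _ => sq_nonneg (pd i u x)).1 (hgrad x) i
      (Finset.mem_univ i)
    exact pow_eq_zero_iff two_ne_zero |>.1 h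
  have hlapu : ∀ x, lap u x = 0 := fun x => by simp [lap, hpd, pd]
  intro x
  have h := heq x
  rw [hlap, hlapu, hgrad] at h
  simp only [zero_div, mul_zero, add_zero, neg_zero, zero_add] at h
  have h1 := (mul_eq_zero.1 h).resolve_left (div_ne_zero hlam0.ne' hp2)
  have h2 : v x ^ (p - 2) = 1 := by
    rw [show p - 2 = p - 1 - 1 by ring, Real.rpow_sub_one (hpos x).ne', ← sub_eq_zero.1 h1,
      div_self (hpos x).ne']
  rwa [← Real.one_rpow (p - 2), Real.rpow_left_inj (hpos x).le zero_le_one hp2] at h2
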